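/- (Theorem 3, existence in the original coordination control framework.) Assume K ⊆ L_{m,1} ∥ L_{m,2} ∥ L_{m,k} and that both K and cl(K) are conditionally decomposable with respect to (Σ₁, Σ₂, Σ_k). Then the following are equivalent: (a) there exist languages N_k ⊆ P_k(K), M₁ ⊆ P_{1+k}(K) and M₂ ⊆ P_{2+k}(K) such that cl(N_k) ⊆ L_k, cl(N_k) is controllable with respect to L_k and Σ_{k,u}, for i = 1, 2, cl(M_i) ⊆ L_i ∥ cl(N_k) and cl(M_i) is controllable with respect to L_i ∥ cl(N_k) and Σ_{i+k,u}, and M₁ ∥ M₂ = K; (b) K is conditionally controllable. -/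

import Mathlib

namespace CoordControl

variable {α : Type*}

/-- Natural projection onto subalphabet `A`: erase all letters outside `A`. -/
noncomputable def proj (A : Set α) (w : List α) : List α :=
  w.filter fun a => @decide (a ∈ A) (Classical.dec _)

/-- Projection of a language. -/
noncomputable def projL (A : Set α) (L : Set (List α)) : Set (List α) :=
  proj A '' L

/-- A word is over alphabet `A`. -/
def WordOver (A : Set α) (w : List α) : Prop := ∀ a ∈ w, a ∈ A

/-- A language is over alphabet `A`. -/
def LangOver (A : Set α) (L : Set (List α)) : Prop := ∀ w ∈ L, WordOver A w

/-- Synchronous product of `L₁` over `A₁` and `L₂` over `A₂`. -/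
def sync (A₁ A₂ : Set α) (L₁ L₂ : Set (List α)) : Set (List α) :=
  {w | WordOver (A₁ ∪ A₂) w ∧ proj A₁ w ∈ L₁ ∧ proj A₂ w ∈ L₂}

/-- Prefix closure. -/
def cl (L : Set (List α)) : Set (List α) := {w | ∃ u, w ++ u ∈ L}

/-- A language is prefix-closed if it equals its prefix closure. -/
def PrefixClosed (L : Set (List α)) : Prop := L = cl L

/-- `K` is controllable with respect to `L` and the uncontrollable events `U`. -/
def Controllable (K L : Set (List α)) (U : Set α) : Prop :=
  ∀ w ∈ cl K, ∀ a ∈ U, w ++ [a] ∈ L → w ++ [a] ∈ cl K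

/-- Supremal controllable sublanguage of `K` w.r.t. `L` and `U`. -/
def supC (K L : Set (List α)) (U : Set α) : Set (List α) :=
  ⋃₀ {M | M ⊆ K ∧ Controllable M L U}

/-- Infimal prefix-closed controllable superlanguage of `K` w.r.t. `L` and `U`. -/
def infC (K L : Set (List α)) (U : Set α) : Set (List α) :=
  ⋂₀ {M | K ⊆ M ∧ PrefixClosed M ∧ Controllable M L U}

/-- `M` over `A₁` and `N` over `A₂` are synchronously nonconflicting. -/
def Nonconflicting (A₁ A₂ : Set α) (M N : Set (List α)) : Prop :=
  cl (sync A₁ A₂ M N) = sync A₁ A₂ (cl M) (cl N)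

/-- The natural projection onto `A` is an `L`-observer. -/
def Observer (A : Set α) (L : Set (List α)) : Prop :=
  ∀ t ∈ projL A L, ∀ s ∈ cl L, proj A s <+: t →
    ∃ u, s ++ u ∈ L ∧ proj A (s ++ u) = t

/-- The natural projection onto `A` is locally control consistent (LCC) for `L`,
with uncontrollable events `U`. -/
def LCC (A U : Set α) (L : Set (List α)) : Prop :=
  ∀ s ∈ cl L, ∀ σ ∈ U ∩ A,
    (∃ u, WordOver Aᶜ u ∧ s ++ u ++ [σ] ∈ cl L) →
    ∃ u', WordOver (Aᶜ ∩ U) u' ∧ s ++ u' ++ [σ] ∈ cl L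

/-- The coordinator `L_k = P_k(L₁) ∥ P_k(L₂)`. -/
noncomputable def coord (Ek : Set α) (L₁ L₂ : Set (List α)) : Set (List α) :=
  sync Ek Ek (projL Ek L₁) (projL Ek L₂)

/-- `K` is conditionally decomposable w.r.t. `(E₁, E₂, Ek)`. -/
noncomputable def CondDecomposable (E₁ E₂ Ek : Set α) (K : Set (List α)) : Prop :=
  K = sync (E₁ ∪ Ek) (E₂ ∪ Ek) (projL (E₁ ∪ Ek) K) (projL (E₂ ∪ Ek) K)

/-- A pair `(M₁, M₂)` is a solution of Problem 1 for the specification `K`: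
`M₁` is over `E₁ ∪ Ek`, `M₂` over `E₂ ∪ Ek`, `cl Mᵢ ⊆ Lᵢ ∥ L_k`, `cl Mᵢ` is
controllable w.r.t. `Lᵢ ∥ L_k` and `Σ_{i+k,u}`, and `M₁ ∥ M₂ = K`,
`cl M₁ ∥ cl M₂ = cl K`. -/
noncomputable def IsSolution (E₁ E₂ Ek U : Set α) (L₁ L₂ K M₁ M₂ : Set (List α)) : Prop :=
  LangOver (E₁ ∪ Ek) M₁ ∧ LangOver (E₂ ∪ Ek) M₂ ∧
  cl M₁ ⊆ sync E₁ Ek L₁ (coord Ek L₁ L₂) ∧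
  cl M₂ ⊆ sync E₂ Ek L₂ (coord Ek L₁ L₂) ∧
  Controllable (cl M₁) (sync E₁ Ek L₁ (coord Ek L₁ L₂)) ((E₁ ∪ Ek) ∩ U) ∧
  Controllable (cl M₂) (sync E₂ Ek L₂ (coord Ek L₁ L₂)) ((E₂ ∪ Ek) ∩ U) ∧
  sync (E₁ ∪ Ek) (E₂ ∪ Ek) M₁ M₂ = K ∧
  sync (E₁ ∪ Ek) (E₂ ∪ Ek) (cl M₁) (cl M₂) = cl K

/-- `M` is relaxed conditionally controllable w.r.t. plants `L₁`, `L₂` and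
coordinator `Lk`. -/
noncomputable def RelaxedCC (E₁ E₂ Ek U : Set α) (L₁ L₂ Lk M : Set (List α)) : Prop :=
  Controllable (projL (E₁ ∪ Ek) M) (sync E₁ Ek L₁ Lk) ((E₁ ∪ Ek) ∩ U) ∧
  Controllable (projL (E₂ ∪ Ek) M) (sync E₂ Ek L₂ Lk) ((E₂ ∪ Ek) ∩ U)

/-- `M` is conditionally controllable (original framework) w.r.t. plants `L₁`, `L₂`
and coordinator `Lk`. -/
noncomputable def CondControllable (E₁ E₂ Ek U : Set α) (L₁ L₂ Lk M : Set (List α)) : Prop :=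
  Controllable (projL Ek M) Lk (Ek ∩ U) ∧
  Controllable (projL (E₁ ∪ Ek) M) (sync E₁ Ek L₁ (cl (projL Ek M))) ((E₁ ∪ Ek) ∩ U) ∧
  Controllable (projL (E₂ ∪ Ek) M) (sync E₂ Ek L₂ (cl (projL Ek M))) ((E₂ ∪ Ek) ∩ U)

theorem proj_append (A : Set α) (v w : List α) : proj A (v ++ w) = proj A v ++ proj A w :=
  List.filter_append ..

theorem wordOver_proj (A : Set α) (w : List α) : WordOver A (proj A w) := by
  intro a ha
  simpa using (List.mem_filter.1 ha).2

theorem proj_proj_of_subset {A B : Set α} (h : A ⊆ B) (w : List α) :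
    proj A (proj B w) = proj A w := by
  simp only [proj, List.filter_filter]
  refine List.filter_congr fun a _ => ?_
  by_cases ha : a ∈ A
  · simp [ha, h ha]
  · simp [ha]

theorem subset_cl (L : Set (List α)) : L ⊆ cl L := fun w hw => ⟨[], by simpa using hw⟩

theorem cl_mono {L M : Set (List α)} (h : L ⊆ M) : cl L ⊆ cl M :=
  fun _ ⟨u, hu⟩ => ⟨u, h hu⟩

theorem cl_cl (L : Set (List α)) : cl (cl L) = cl L := by
  refine Set.Subset.antisymm ?_ (subset_cl _)
  rintro w ⟨u, v, h⟩
  exact ⟨u ++ v, by simpa using h⟩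

theorem controllable_cl_iff {K L : Set (List α)} {U : Set α} :
    Controllable (cl K) L U ↔ Controllable K L U := by
  simp only [Controllable, cl_cl]

theorem PrefixClosed.cl_subset {L M : Set (List α)} (hM : PrefixClosed M) (h : L ⊆ M) :
    cl L ⊆ M :=
  (cl_mono h).trans (Eq.ge hM)

theorem cl_subset_sync {E A : Set α} {L N M : Set (List α)} (hL : PrefixClosed L)
    (hN : PrefixClosed N) (h : M ⊆ sync E A L N) : cl M ⊆ sync E A L N := by
  rintro w ⟨u, hu⟩
  obtain ⟨h₀, h₁, h₂⟩ := h hu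
  rw [proj_append] at h₁ h₂
  exact ⟨fun a ha => h₀ a (List.mem_append_left u ha), Eq.ge hL ⟨_, h₁⟩, Eq.ge hN ⟨_, h₂⟩⟩

theorem cl_projL_subset_sync {E A : Set α} {L K : Set (List α)} (hL : PrefixClosed L)
    (h : ∀ w ∈ K, proj E w ∈ L) :
    cl (projL (E ∪ A) K) ⊆ sync E A L (cl (projL A K)) := by
  refine cl_subset_sync hL (cl_cl _).symm ?_
  rintro _ ⟨w, hw, rfl⟩
  refine ⟨wordOver_proj _ _, ?_, subset_cl _ ⟨w, hw, ?_⟩⟩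
  · rw [proj_proj_of_subset Set.subset_union_left]
    exact h w hw
  · rw [proj_proj_of_subset Set.subset_union_right]

theorem cl_eq_cl_projL {E A : Set α} {L N K : Set (List α)} (hN : N ⊆ projL A K)
    (h : projL (E ∪ A) K ⊆ sync E A L (cl N)) : cl N = cl (projL A K) := by
  refine Set.Subset.antisymm (cl_mono hN) ?_
  rw [← cl_cl N]
  refine cl_mono ?_
  rintro _ ⟨w, hw, rfl⟩
  simpa only [proj_proj_of_subset Set.subset_union_right] using (h ⟨w, hw, rfl⟩).2.2

/-- Theorem 3: existence in the original coordination control framework. -/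
theorem thm3_existence_original_framework
    (E₁ E₂ Ek U : Set α)
    (hUniv : E₁ ∪ E₂ = (Set.univ : Set α))
    (hInter : E₁ ∩ E₂ ⊆ Ek) (hSub : Ek ⊆ E₁ ∪ E₂)
    (L₁ L₂ Lm1 Lm2 : Set (List α))
    (hO1 : LangOver E₁ L₁) (hO2 : LangOver E₂ L₂)
    (hP1 : PrefixClosed L₁) (hP2 : PrefixClosed L₂)
    (hm1 : Lm1 ⊆ L₁) (hm2 : Lm2 ⊆ L₂)
    (hc1 : cl Lm1 = L₁) (hc2 : cl Lm2 = L₂)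
    (Lk Lmk : Set (List α))
    (hOk : LangOver Ek Lk) (hPk : PrefixClosed Lk)
    (hmk : Lmk ⊆ Lk) (hck : cl Lmk = Lk)
    (K : Set (List α))
    (hK : K ⊆ sync (E₁ ∪ E₂) Ek (sync E₁ E₂ Lm1 Lm2) Lmk)
    (hCD : CondDecomposable E₁ E₂ Ek K)
    (hCDcl : CondDecomposable E₁ E₂ Ek (cl K)) :
    (∃ Nk M₁ M₂ : Set (List α),
      Nk ⊆ projL Ek K ∧
      M₁ ⊆ projL (E₁ ∪ Ek) K ∧
      M₂ ⊆ projL (E₂ ∪ Ek) K ∧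
      cl Nk ⊆ Lk ∧
      Controllable (cl Nk) Lk (Ek ∩ U) ∧
      cl M₁ ⊆ sync E₁ Ek L₁ (cl Nk) ∧
      Controllable (cl M₁) (sync E₁ Ek L₁ (cl Nk)) ((E₁ ∪ Ek) ∩ U) ∧
      cl M₂ ⊆ sync E₂ Ek L₂ (cl Nk) ∧
      Controllable (cl M₂) (sync E₂ Ek L₂ (cl Nk)) ((E₂ ∪ Ek) ∩ U) ∧
      sync (E₁ ∪ Ek) (E₂ ∪ Ek) M₁ M₂ = K) ↔
    CondControllable E₁ E₂ Ek U L₁ L₂ Lk K := by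
  constructor
  · rintro ⟨Nk, M₁, M₂, hNk, hM₁, hM₂, -, hcNk, hs₁, hcM₁, -, hcM₂, hsync⟩
    obtain rfl : M₁ = projL (E₁ ∪ Ek) K := by
      refine hM₁.antisymm ?_
      rintro _ ⟨w, hw, rfl⟩
      rw [← hsync] at hw
      exact hw.2.1
    obtain rfl : M₂ = projL (E₂ ∪ Ek) K := by
      refine hM₂.antisymm ?_
      rintro _ ⟨w, hw, rfl⟩
      rw [← hsync] at hw
      exact hw.2.2
    rw [cl_eq_cl_projL hNk ((subset_cl _).trans hs₁)] at hcNk hcM₁ hcM₂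
    exact ⟨controllable_cl_iff.1 hcNk, controllable_cl_iff.1 hcM₁, controllable_cl_iff.1 hcM₂⟩
  · rintro ⟨hck, hc₁, hc₂⟩
    refine ⟨projL Ek K, projL (E₁ ∪ Ek) K, projL (E₂ ∪ Ek) K, subset_rfl, subset_rfl, subset_rfl,
      hPk.cl_subset ?_, controllable_cl_iff.2 hck,
      cl_projL_subset_sync hP1 fun w hw => ?_, controllable_cl_iff.2 hc₁,
      cl_projL_subset_sync hP2 fun w hw => ?_, controllable_cl_iff.2 hc₂, Eq.symm hCD⟩
    · rintro _ ⟨w, hw, rfl⟩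
      exact hmk (hK hw).2.2
    · have h := (hK hw).2.1.2.1
      rw [proj_proj_of_subset Set.subset_union_left] at h
      exact hm1 h
    · have h := (hK hw).2.1.2.2
      rw [proj_proj_of_subset Set.subset_union_right] at h
      exact hm2 h

end CoordControl
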